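/- Let g, b > 0, μ = 1 − g − b, M = ![![1−b, b], ![g, 1−g]], and k a natural number. Consider the joint probability mass function J on (Bool × Bool) × (Bool × Bool) of the previous construction specialized to the original Gilbert–Elliott channel with p = 0 and q = 1 (the Good state is erasure-free and the Bad state always erases): J((c₀,x₀),(c,x)) = π(c₀)·em(c₀,x₀)·(M^k)(c₀,c)·em(c,x) with π(G) = g/(g+b), π(B) = b/(g+b), em(G,1) = 0, em(G,0) = 1, em(B,1) = 1, em(B,0) = 0. Then the conditional probability under J of {x = 1} given {x₀ = 1} equals 1 − g·∑_{i<k} μ^i, and the conditional probability of {x = 1} given {x₀ = 0} equals b·∑_{i<k} μ^i. -/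

import Mathlib

/-- Index of a channel state: Good (`true`) ↦ 0, Bad (`false`) ↦ 1. -/
def stateIdx : Bool → Fin 2 := fun c => if c then 0 else 1

/-- Stationary distribution of the Gilbert–Elliott channel. -/
noncomputable def statPi (g b : ℝ) : Bool → ℝ :=
  fun c => if c then g / (g + b) else b / (g + b)

/-- Emission probabilities of the original Gilbert–Elliott channel (p = 0, q = 1):
the Good state is erasure-free and the Bad state always erases. -/
def emis01 : Bool → Bool → ℝ :=
  fun c x => if c then (if x then 0 else 1) else (if x then 1 else 0)

/-- Joint probability mass function of (state, erasure) at an initial time and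
`k` steps later, for the original Gilbert–Elliott channel (p = 0, q = 1). -/
noncomputable def jointJ01 (g b : ℝ) (k : ℕ) :
    (Bool × Bool) × (Bool × Bool) → ℝ :=
  fun s => statPi g b s.1.1 * emis01 s.1.1 s.1.2 *
    ((!![1 - b, b; g, 1 - g] : Matrix (Fin 2) (Fin 2) ℝ) ^ k)
      (stateIdx s.1.1) (stateIdx s.2.1) * emis01 s.2.1 s.2.2

/-- Powers of a two-state transition matrix, in terms of geometric sums of its memory. -/
theorem two_state_transition_pow {R : Type*} [CommRing R] (g b : R) (k : ℕ) :
    (!![1 - b, b; g, 1 - g] : Matrix (Fin 2) (Fin 2) R) ^ k =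
      !![1 - b * ∑ i ∈ Finset.range k, (1 - g - b) ^ i, b * ∑ i ∈ Finset.range k, (1 - g - b) ^ i;
        g * ∑ i ∈ Finset.range k, (1 - g - b) ^ i,
        1 - g * ∑ i ∈ Finset.range k, (1 - g - b) ^ i] := by
  induction k with
  | zero => simp [Matrix.one_fin_two]
  | succ k ih =>
    rw [pow_succ', ih, geom_sum_succ, Matrix.mul_fin_two]
    congr! 3 <;> ring_nf

/-- For the original Gilbert–Elliott channel (p = 0, q = 1), the probability of an
erasure `k` steps after an erasure is 1 − g·∑_{i<k} μ^i, and after a reception it is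
b·∑_{i<k} μ^i, where μ = 1 − g − b. -/
theorem erasure_prob_original_GE (g b : ℝ) (hg : 0 < g) (hb : 0 < b)
    (μ : ℝ) (hμ : μ = 1 - g - b) (k : ℕ) :
    (∑ s : (Bool × Bool) × (Bool × Bool),
        if s.2.2 = true ∧ s.1.2 = true then jointJ01 g b k s else 0) /
      (∑ s : (Bool × Bool) × (Bool × Bool),
        if s.1.2 = true then jointJ01 g b k s else 0) =
      1 - g * ∑ i ∈ Finset.range k, μ ^ i ∧
    (∑ s : (Bool × Bool) × (Bool × Bool),
        if s.2.2 = true ∧ s.1.2 = false then jointJ01 g b k s else 0) /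
      (∑ s : (Bool × Bool) × (Bool × Bool),
        if s.1.2 = false then jointJ01 g b k s else 0) =
      b * ∑ i ∈ Finset.range k, μ ^ i := by
  subst hμ
  have hgb : g + b ≠ 0 := (add_pos hg hb).ne'
  simp only [Fintype.sum_prod_type, Fintype.sum_bool, jointJ01, statPi, emis01, stateIdx,
    two_state_transition_pow]
  constructor
  · simp
    field_simp
    ring
  · simp
    field_simp
    ring
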